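/- Let f, g : [0,1] → [0,1] be continuous, transitive, piecewise monotone maps of constant slopes α and β respectively, and let φ : [0,1] → [0,1] be an increasing homeomorphism such that φ ∘ f = g ∘ φ. Then φ is the identity map; in particular f = g and α = β. -/

import Mathlib

open Set

/-- `f` scales by `A` (and by `B` in the `φ`-metric) on intervals whose interior misses `S`. -/
def GoodMap (f φ : ℝ → ℝ) (A B : ℝ) (S : Set ℝ) : Prop :=
  ∀ x ∈ Icc (0:ℝ) 1, ∀ y ∈ Icc (0:ℝ) 1, x ≤ y → (∀ z ∈ S, ¬ (x < z ∧ z < y)) →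
    |f x - f y| = A * |x - y| ∧ |φ (f x) - φ (f y)| = B * |φ x - φ y|

lemma finite_of_sep {S T : Set ℝ} (hS : S.Finite)
    (h : ∀ u ∈ T, ∀ v ∈ T, u < v → ∃ z ∈ S, u < z ∧ z < v) : T.Finite := by
  refine Set.Finite.of_injOn (f := fun t : ℝ => S ∩ Iic t) (t := 𝒫 S) ?_ ?_ hS.powerset
  · intro t _
    exact inter_subset_left
  · have key : ∀ u ∈ T, ∀ v ∈ T, u < v → S ∩ Iic u ≠ S ∩ Iic v := by
      intro u hu v hv huv he
      obtain ⟨z, hz, h1, h2⟩ := h u hu v hv huv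
      have : z ∈ S ∩ Iic v := ⟨hz, h2.le⟩
      rw [← he] at this
      exact absurd this.2 (not_le.2 h1)
    intro u hu v hv he
    rcases lt_trichotomy u v with h1 | h1 | h1
    · exact absurd he (key u hu v hv h1)
    · exact h1
    · exact absurd he.symm (key v hv u hu h1)

lemma exists_gap {S : Set ℝ} (hS : S.Finite) {a b : ℝ} (hab : a < b) :
    ∃ x y, a < x ∧ x < y ∧ y < b ∧ ∀ z ∈ S, ¬ (x < z ∧ z < y) := by
  obtain ⟨x, hx, hxS⟩ := ((Ioo_infinite hab).sdiff hS).nonempty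
  have ho : IsOpen (Ioo a b ∩ Sᶜ) := isOpen_Ioo.inter hS.isClosed.isOpen_compl
  obtain ⟨e, he, hb⟩ := Metric.isOpen_iff.1 ho x ⟨hx, hxS⟩
  have hm : ∀ t, x ≤ t → t < x + e → t ∈ Ioo a b ∩ Sᶜ := by
    intro t h1 h2
    apply hb
    rw [Metric.mem_ball, Real.dist_eq, abs_of_nonneg (by linarith)]
    linarith
  refine ⟨x, x + e/2, hx.1, by linarith, (hm _ (by linarith) (by linarith)).1.2, ?_⟩
  rintro z hz ⟨h1, h2⟩
  exact (hm z h1.le (by linarith)).2 hz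

lemma exists_sep {S : Set ℝ} (hS : S.Finite) :
    ∃ δ > 0, δ ≤ 1 ∧ ∀ u ∈ S, ∀ v ∈ S, u < v → δ ≤ v - u := by
  induction S, hS using Set.Finite.induction_on with
  | empty => exact ⟨1, one_pos, le_rfl, by simp⟩
  | @insert a S ha hS ih =>
    obtain ⟨δ, h0, h1, h2⟩ := ih
    obtain ⟨e, he, hb⟩ := Metric.isOpen_iff.1 hS.isClosed.isOpen_compl a ha
    have hd : ∀ v ∈ S, e ≤ |v - a| := by
      intro v hv
      by_contra hc
      exact hb (show v ∈ Metric.ball a e by rw [Metric.mem_ball, Real.dist_eq]; linarith) hv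
    refine ⟨min δ e, lt_min h0 he, (min_le_left _ _).trans h1, ?_⟩
    rintro u (rfl | hu) v (rfl | hv) huv
    · exact absurd huv (lt_irrefl _)
    · have := hd v hv
      rw [abs_of_pos (by linarith)] at this
      exact (min_le_right _ _).trans this
    · have := hd u hu
      rw [abs_of_neg (by linarith)] at this
      exact (min_le_right _ _).trans (by linarith)
    · exact (min_le_left _ _).trans (h2 u hu v hv huv)

lemma iterate_good {f φ : ℝ → ℝ} {A B : ℝ} {S : Set ℝ} (hS : S.Finite)
    (hf : MapsTo f (Icc 0 1) (Icc 0 1)) (hfc : ContinuousOn f (Icc 0 1)) (hA : 0 < A)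
    (h : GoodMap f φ A B S) (n : ℕ) :
    ∃ T : Set ℝ, T.Finite ∧ GoodMap f^[n] φ (A ^ n) (B ^ n) T := by
  induction n with
  | zero => exact ⟨∅, finite_empty, fun x _ y _ _ _ => by simp⟩
  | succ n ih =>
    obtain ⟨T, hT, hG⟩ := ih
    refine ⟨S ∪ (⋃ w ∈ T, {u | u ∈ Icc (0:ℝ) 1 ∧ f u = w}), ?_, ?_⟩
    · refine hS.union (hT.biUnion fun w _ => finite_of_sep hS ?_)
      rintro u ⟨hu, hu'⟩ v ⟨hv, hv'⟩ huv
      by_contra hc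
      push Not at hc
      have := (h u hu v hv huv.le (fun z hz hh => absurd (hc z hz hh.1) (not_le.2 hh.2))).1
      rw [hu', hv', sub_self, abs_zero] at this
      have h2 : 0 < |u - v| := abs_pos.2 (by linarith)
      have := mul_pos hA h2
      linarith
    · intro x hx y hy hxy hz
      have h1 := h x hx y hy hxy (fun z hzS => hz z (Or.inl hzS))
      have hmiss : ∀ w ∈ T, ¬ (min (f x) (f y) < w ∧ w < max (f x) (f y)) := by
        rintro w hw ⟨ha, hb⟩
        have hsub : uIcc x y ⊆ Icc (0:ℝ) 1 := by
          rw [uIcc_of_le hxy]; exact Icc_subset_Icc hx.1 hy.2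
        obtain ⟨u, hu, huw⟩ := intermediate_value_uIcc (hfc.mono hsub)
          (show w ∈ uIcc (f x) (f y) from ⟨ha.le, hb.le⟩)
        have huI := hsub hu
        rw [uIcc_of_le hxy] at hu
        refine hz u (Or.inr (mem_biUnion hw ⟨huI, huw⟩)) ⟨lt_of_le_of_ne hu.1 ?_, lt_of_le_of_ne hu.2 ?_⟩
        · rintro rfl
          rw [← huw] at ha hb
          rcases le_total (f x) (f y) with h | h <;> simp_all
          all_goals exact absurd ha (lt_asymm hb)
        · rintro rfl
          rw [← huw] at ha hb
          rcases le_total (f x) (f u) with h | h <;> simp_all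
          all_goals exact absurd ha (lt_asymm hb)
      have h2 : |f^[n] (f x) - f^[n] (f y)| = A^n * |f x - f y| ∧
          |φ (f^[n] (f x)) - φ (f^[n] (f y))| = B^n * |φ (f x) - φ (f y)| := by
        rcases le_total (f x) (f y) with hle | hle
        · rw [min_eq_left hle, max_eq_right hle] at hmiss
          exact hG _ (hf hx) _ (hf hy) hle hmiss
        · rw [min_eq_right hle, max_eq_left hle] at hmiss
          have := hG _ (hf hy) _ (hf hx) hle hmiss
          rw [abs_sub_comm, abs_sub_comm (f x), abs_sub_comm (φ _), abs_sub_comm (φ (f x))]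
          exact this
      simp only [Function.iterate_succ_apply]
      rw [h2.1, h2.2, h1.1, h1.2]
      constructor <;> ring

lemma core {F φ : ℝ → ℝ} {A B : ℝ} {S : Set ℝ} (hS : S.Finite)
    (hF : MapsTo F (Icc 0 1) (Icc 0 1)) (hφ : MapsTo φ (Icc 0 1) (Icc 0 1))
    (hφc : ContinuousOn φ (Icc 0 1)) (hφm : StrictMonoOn φ (Icc 0 1))
    (hAB : A ≤ B) (hB : 2 < B) (h : GoodMap F φ A B S) :
    A = B ∧ ∃ L a b, 0 ≤ a ∧ a < b ∧ b ≤ 1 ∧ φ b - φ a = L * (b - a) ∧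
      ∀ x ∈ Icc (0:ℝ) 1, ∀ y ∈ Icc (0:ℝ) 1, x ≤ y → φ y - φ x ≤ L * (y - x) := by
  obtain ⟨δ, hδ, hδ1, hsep⟩ := exists_sep hS
  have hB0 : 0 < B := by linarith
  let K : Set (ℝ × ℝ) := (Icc (0:ℝ) 1 ×ˢ Icc (0:ℝ) 1) ∩ {p | δ ≤ p.2 - p.1}
  have hK : IsCompact K := (isCompact_Icc.prod isCompact_Icc).inter_right
    (isClosed_le continuous_const (continuous_snd.sub continuous_fst))
  have h01 : ((0:ℝ), (1:ℝ)) ∈ K := ⟨⟨by simp, by simp⟩, by simpa using hδ1⟩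
  have hc : ContinuousOn (fun p : ℝ × ℝ => (φ p.2 - φ p.1) / (p.2 - p.1)) K := by
    refine ContinuousOn.div ?_ (by fun_prop) ?_
    · exact (hφc.comp continuousOn_snd fun p hp => hp.1.2).sub
        (hφc.comp continuousOn_fst fun p hp => hp.1.1)
    · intro p hp
      have : δ ≤ p.2 - p.1 := hp.2
      linarith
  obtain ⟨⟨a, b⟩, ⟨⟨ha, hb⟩, hab⟩, hmax⟩ := hK.exists_isMaxOn ⟨_, h01⟩ hc
  simp only [mem_ofPred_eq] at ha hb hab
  set L := (φ b - φ a) / (b - a) with hL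
  have hLpos : 0 < L := div_pos (sub_pos.2 (hφm ha hb (by linarith))) (by linarith)
  have hbig : ∀ x ∈ Icc (0:ℝ) 1, ∀ y ∈ Icc (0:ℝ) 1, δ ≤ y - x → φ y - φ x ≤ L * (y - x) := by
    intro x hx y hy hxy
    have : (φ y - φ x) / (y - x) ≤ L := hmax (show (x, y) ∈ K from ⟨⟨hx, hy⟩, hxy⟩)
    rwa [div_le_iff₀ (by linarith)] at this
  have hn : ∀ n : ℕ, ∀ x ∈ Icc (0:ℝ) 1, ∀ y ∈ Icc (0:ℝ) 1, x ≤ y →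
      φ y - φ x ≤ L * (y - x) + (2 / B) ^ n := by
    intro n
    induction n with
    | zero =>
      intro x hx y hy hxy
      have := mul_nonneg hLpos.le (sub_nonneg.2 hxy)
      have := (hφ hx).1
      have := (hφ hy).2
      simp
      linarith
    | succ n ih =>
      have hpos : 0 < (2 / B) ^ n := by positivity
      have haux : ∀ x ∈ Icc (0:ℝ) 1, ∀ y ∈ Icc (0:ℝ) 1, x ≤ y →
          (∀ z ∈ S, ¬ (x < z ∧ z < y)) →
          φ y - φ x ≤ L * (y - x) + (2 / B) ^ n / B := by
        intro x hx y hy hxy hz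
        obtain ⟨h1, h2⟩ := h x hx y hy hxy hz
        rw [abs_sub_comm x, abs_of_nonneg (sub_nonneg.2 hxy)] at h1
        rw [abs_sub_comm (φ x), abs_of_nonneg (sub_nonneg.2 (hφm.monotoneOn hx hy hxy))] at h2
        have h3 : |φ (F x) - φ (F y)| ≤ L * |F x - F y| + (2 / B) ^ n := by
          rcases le_total (F x) (F y) with hle | hle
          · rw [abs_sub_comm, abs_sub_comm (F x), abs_of_nonneg (sub_nonneg.2 hle),
              abs_of_nonneg (sub_nonneg.2 (hφm.monotoneOn (hF hx) (hF hy) hle))]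
            exact ih _ (hF hx) _ (hF hy) hle
          · rw [abs_of_nonneg (sub_nonneg.2 hle),
              abs_of_nonneg (sub_nonneg.2 (hφm.monotoneOn (hF hy) (hF hx) hle))]
            exact ih _ (hF hy) _ (hF hx) hle
        rw [h1, h2] at h3
        have h4 : L * (A * (y - x)) ≤ L * (B * (y - x)) := by
          gcongr
        have h5 : B * (φ y - φ x) ≤ B * (L * (y - x) + (2 / B) ^ n / B) := by
          have : B * (L * (y - x) + (2 / B) ^ n / B) = L * (B * (y - x)) + (2 / B) ^ n := by
            field_simp
          linarith
        exact le_of_mul_le_mul_left h5 hB0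
      have he : (2 / B) ^ (n + 1) = (2 / B) ^ n / B + (2 / B) ^ n / B := by
        rw [pow_succ]; ring
      have hpos2 : 0 < (2 / B) ^ n / B := by positivity
      intro x hx y hy hxy
      by_cases hd : δ ≤ y - x
      · have := hbig x hx y hy hd
        linarith
      by_cases hz : ∀ z ∈ S, ¬ (x < z ∧ z < y)
      · have := haux x hx y hy hxy hz
        linarith
      push Not at hz
      obtain ⟨z, hzS, hxz, hzy⟩ := hz
      have hzI : z ∈ Icc (0:ℝ) 1 := ⟨hx.1.trans hxz.le, hzy.le.trans hy.2⟩
      have h1 := haux x hx z hzI hxz.le (by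
        rintro w hw ⟨h1, h2⟩
        have := hsep w hw z hzS h2
        linarith)
      have h2 := haux z hzI y hy hzy.le (by
        rintro w hw ⟨h1, h2⟩
        have := hsep z hzS w hw h1
        linarith)
      linarith
  have hlip : ∀ x ∈ Icc (0:ℝ) 1, ∀ y ∈ Icc (0:ℝ) 1, x ≤ y → φ y - φ x ≤ L * (y - x) := by
    intro x hx y hy hxy
    have ht : Filter.Tendsto (fun n : ℕ => L * (y - x) + (2 / B) ^ n) Filter.atTop
        (nhds (L * (y - x) + 0)) :=
      tendsto_const_nhds.add (tendsto_pow_atTop_nhds_zero_of_lt_one (by positivity)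
        (by rw [div_lt_one hB0]; exact hB))
    rw [add_zero] at ht
    exact ge_of_tendsto' ht fun n => hn n x hx y hy hxy
  have heq : φ b - φ a = L * (b - a) := by
    rw [hL, div_mul_cancel₀]; linarith
  refine ⟨le_antisymm hAB ?_, L, a, b, ha.1, by linarith, hb.2, heq, hlip⟩
  obtain ⟨x, y, hax, hxy, hyb, hz⟩ := exists_gap hS (show a < b by linarith)
  have hx : x ∈ Icc (0:ℝ) 1 := ⟨ha.1.trans hax.le, by linarith [hb.2]⟩
  have hy : y ∈ Icc (0:ℝ) 1 := ⟨by linarith [ha.1], by linarith [hb.2]⟩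
  obtain ⟨h1, h2⟩ := h x hx y hy hxy.le hz
  rw [abs_sub_comm x, abs_of_pos (sub_pos.2 hxy)] at h1
  rw [abs_sub_comm (φ x), abs_of_pos (sub_pos.2 (hφm hx hy hxy))] at h2
  have h3 : |φ (F x) - φ (F y)| ≤ L * |F x - F y| := by
    rcases le_total (F x) (F y) with hle | hle
    · rw [abs_sub_comm, abs_sub_comm (F x), abs_of_nonneg (sub_nonneg.2 hle),
        abs_of_nonneg (sub_nonneg.2 (hφm.monotoneOn (hF hx) (hF hy) hle))]
      exact hlip _ (hF hx) _ (hF hy) hle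
    · rw [abs_of_nonneg (sub_nonneg.2 hle),
        abs_of_nonneg (sub_nonneg.2 (hφm.monotoneOn (hF hy) (hF hx) hle))]
      exact hlip _ (hF hy) _ (hF hx) hle
  have e1 := hlip a ha x hx hax.le
  have e2 := hlip y hy b hb hyb.le
  have e3 : L * (y - x) ≤ φ y - φ x := by nlinarith
  rw [h1, h2] at h3
  have h4 : B * (L * (y - x)) ≤ B * (φ y - φ x) := by gcongr
  have h5 : 0 < L * (y - x) := mul_pos hLpos (sub_pos.2 hxy)
  have h6 : B * (L * (y - x)) ≤ A * (L * (y - x)) := by linarith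
  exact le_of_mul_le_mul_right h6 h5

/-- Piecewise constant slope, as in the statement. -/
def PCS (f : ℝ → ℝ) (α : ℝ) : Prop :=
  ∃ (m : ℕ) (s : ℕ → ℝ), 0 < m ∧ s 0 = 0 ∧ s m = 1 ∧
      (∀ j < m, s j < s (j + 1)) ∧
      ∀ j < m, ∀ u ∈ Icc (s j) (s (j + 1)), ∀ v ∈ Icc (s j) (s (j + 1)),
        |f u - f v| = α * |u - v|

lemma PCS.finset {f : ℝ → ℝ} {α : ℝ} (h : PCS f α) : ∃ S : Set ℝ, S.Finite ∧
    ∀ x ∈ Icc (0:ℝ) 1, ∀ y ∈ Icc (0:ℝ) 1, x ≤ y → (∀ z ∈ S, ¬ (x < z ∧ z < y)) →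
    |f x - f y| = α * |x - y| := by
  obtain ⟨m, s, hm, h0, h1, hs, hsl⟩ := h
  refine ⟨s '' (Iic m), (finite_Iic m).image s, ?_⟩
  intro x hx y hy hxy hz
  rcases hxy.eq_or_lt with rfl | hxy
  · simp
  have key : ∀ j ≤ m, x < s j → ∃ i < j, s i ≤ x ∧ x < s (i + 1) := by
    intro j
    induction j with
    | zero => intro _ h; rw [h0] at h; linarith [hx.1]
    | succ j ih =>
      intro hj hxj
      by_cases hc : x < s j
      · obtain ⟨i, hi, h⟩ := ih (by omega) hc
        exact ⟨i, by omega, h⟩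
      · exact ⟨j, by omega, not_lt.1 hc, hxj⟩
  obtain ⟨i, hi, h2, h3⟩ := key m le_rfl (by rw [h1]; linarith [hy.2])
  have h4 : y ≤ s (i + 1) := by
    by_contra hc
    exact hz (s (i + 1)) ⟨i + 1, by simp; omega, rfl⟩ ⟨h3, not_le.1 hc⟩
  exact hsl i hi x ⟨h2, h3.le⟩ y ⟨by linarith, h4⟩

lemma PCS.lip {f : ℝ → ℝ} {α : ℝ} (h : PCS f α) (hα : α ≤ 1) :
    ∀ x ∈ Icc (0:ℝ) 1, ∀ y ∈ Icc (0:ℝ) 1, x ≤ y → |f x - f y| ≤ y - x := by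
  obtain ⟨m, s, hm, h0, h1, hs, hsl⟩ := h
  have key : ∀ j ≤ m, ∀ x, 0 ≤ x → ∀ y, x ≤ y → y ≤ s j → |f x - f y| ≤ y - x := by
    intro j
    induction j with
    | zero =>
      intro _ x hx y hxy hy
      rw [h0] at hy
      have : x = y := by linarith
      simp [this]
    | succ j ih =>
      intro hj x hx y hxy hy
      have hloc : ∀ u v, s j ≤ u → u ≤ v → v ≤ s (j + 1) → |f u - f v| ≤ v - u := by
        intro u v h1 h2 h3
        rw [hsl j (by omega) u ⟨h1, by linarith⟩ v ⟨by linarith, h3⟩, abs_sub_comm,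
          abs_of_nonneg (by linarith)]
        nlinarith
      rcases le_total y (s j) with hyj | hyj
      · exact ih (by omega) x hx y hxy hyj
      rcases le_total x (s j) with hxj | hxj
      · have e1 := ih (by omega) x hx (s j) hxj le_rfl
        have e2 := hloc (s j) y le_rfl hyj hy
        have := abs_sub_le (f x) (f (s j)) (f y)
        linarith
      · exact hloc x y hxj hxy hy
  intro x hx y hy hxy
  exact key m le_rfl x hx.1 y hxy (by rw [h1]; exact hy.2)

def TransMap (f : ℝ → ℝ) : Prop := ∃ x₀ ∈ Icc (0 : ℝ) 1,
      Icc (0 : ℝ) 1 ⊆ closure (Set.range fun n : ℕ => f^[n] x₀)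

lemma orbit_hits {f : ℝ → ℝ} {x₀ : ℝ}
    (h : Icc (0 : ℝ) 1 ⊆ closure (Set.range fun n : ℕ => f^[n] x₀)) {a b : ℝ} (ha : 0 ≤ a)
    (hab : a < b) (hb : b ≤ 1) (N : ℕ) : ∃ n, N ≤ n ∧ f^[n] x₀ ∈ Ioo a b := by
  let T : Set ℝ := (fun n : ℕ => f^[n] x₀) '' (Iio N)
  have hT : T.Finite := (finite_Iio N).image _
  obtain ⟨x, hx, hxT⟩ := ((Ioo_infinite hab).sdiff hT).nonempty
  have ho : IsOpen (Ioo a b ∩ Tᶜ) := isOpen_Ioo.inter hT.isClosed.isOpen_compl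
  have hx1 : x ∈ Icc (0:ℝ) 1 := ⟨ha.trans hx.1.le, hx.2.le.trans hb⟩
  obtain ⟨y, ⟨hy, hyT⟩, n, rfl⟩ := mem_closure_iff.1 (h hx1) _ ho ⟨hx, hxT⟩
  refine ⟨n, ?_, hy⟩
  by_contra hc
  exact hyT ⟨n, not_le.1 hc, rfl⟩

lemma orbit_mem {f : ℝ → ℝ} (hf : MapsTo f (Icc 0 1) (Icc 0 1)) {x₀ : ℝ}
    (hx : x₀ ∈ Icc (0:ℝ) 1) (n : ℕ) : f^[n] x₀ ∈ Icc (0:ℝ) 1 := hf.iterate n hx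

lemma slope_gt_one {f : ℝ → ℝ} {α : ℝ} (hf : MapsTo f (Icc 0 1) (Icc 0 1))
    (hfc : ContinuousOn f (Icc 0 1)) (h : PCS f α) (ht : TransMap f) : 1 < α := by
  by_contra hα
  have hl := h.lip (not_lt.1 hα)
  obtain ⟨x₀, hx₀, hd⟩ := ht
  have hsurj : Icc (0:ℝ) 1 ⊆ f '' Icc 0 1 := by
    have hcl : IsClosed (f '' Icc 0 1) := (isCompact_Icc.image_of_continuousOn hfc).isClosed
    have h1 : Ioo (0:ℝ) 1 ⊆ f '' Icc 0 1 := by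
      intro y hy
      rw [← hcl.closure_eq, Metric.mem_closure_iff]
      intro e he
      obtain ⟨n, hn, h2⟩ := orbit_hits hd (a := y) (b := min (y + e) 1) hy.1.le
        (lt_min (by linarith) hy.2) (min_le_right _ _) 1
      obtain ⟨k, rfl⟩ : ∃ k, n = k + 1 := ⟨n - 1, by omega⟩
      rw [Function.iterate_succ_apply'] at h2
      refine ⟨_, ⟨_, orbit_mem hf hx₀ k, rfl⟩, ?_⟩
      have := (lt_min_iff.1 h2.2).1
      rw [Real.dist_eq, abs_sub_comm, abs_of_pos (by linarith [h2.1])]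
      linarith
    have h3 := closure_minimal h1 hcl
    rwa [closure_Ioo (zero_ne_one (α := ℝ))] at h3
  have h0m : (0:ℝ) ∈ Icc (0:ℝ) 1 := by simp
  have h1m : (1:ℝ) ∈ Icc (0:ℝ) 1 := by simp
  obtain ⟨a, ha, ha0⟩ := hsurj h0m
  obtain ⟨b, hb, hb1⟩ := hsurj h1m
  have hff : ∀ x ∈ Icc (0:ℝ) 1, f (f x) = x := by
    have hcase : (f 0 = 0 ∧ f 1 = 1) ∨ (f 0 = 1 ∧ f 1 = 0) := by
      rcases le_total a b with hab | hab
      · have := hl a ha b hb hab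
        rw [ha0, hb1] at this
        norm_num at this
        have e1 : a = 0 := by linarith [ha.1, hb.2]
        have e2 : b = 1 := by linarith [ha.1, hb.2]
        subst e1 e2
        exact Or.inl ⟨ha0, hb1⟩
      · have := hl b hb a ha hab
        rw [ha0, hb1] at this
        norm_num at this
        have e1 : b = 0 := by linarith [hb.1, ha.2]
        have e2 : a = 1 := by linarith [hb.1, ha.2]
        subst e1 e2
        exact Or.inr ⟨hb1, ha0⟩
    rcases hcase with ⟨e0, e1⟩ | ⟨e0, e1⟩
    · have : ∀ x ∈ Icc (0:ℝ) 1, f x = x := by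
        intro x hx
        have p1 := abs_le.1 (hl 0 h0m x hx hx.1)
        have p2 := abs_le.1 (hl x hx 1 h1m hx.2)
        rw [e0] at p1
        rw [e1] at p2
        linarith [p1.1, p2.1]
      intro x hx
      rw [this x hx, this x hx]
    · have : ∀ x ∈ Icc (0:ℝ) 1, f x = 1 - x := by
        intro x hx
        have p1 := abs_le.1 (hl 0 h0m x hx hx.1)
        have p2 := abs_le.1 (hl x hx 1 h1m hx.2)
        rw [e0] at p1
        rw [e1] at p2
        linarith [p1.2, p2.2]
      intro x hx
      rw [this _ (hf hx), this x hx]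
      ring
  have horb : ∀ n, f^[n] x₀ = x₀ ∨ f^[n] x₀ = f x₀ := by
    intro n
    induction n with
    | zero => simp
    | succ n ih =>
      rw [Function.iterate_succ_apply']
      rcases ih with h | h <;> rw [h]
      · exact Or.inr rfl
      · exact Or.inl (hff _ hx₀)
  have hfin : ({x₀, f x₀} : Set ℝ).Finite := toFinite _
  have : Icc (0:ℝ) 1 ⊆ {x₀, f x₀} := by
    rw [← hfin.isClosed.closure_eq]
    refine hd.trans (closure_mono ?_)
    rintro _ ⟨n, rfl⟩
    exact horb n
  exact (Icc_infinite (zero_lt_one (α := ℝ))) (hfin.subset this)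

lemma goodMap_of {f g φ : ℝ → ℝ} {α β : ℝ} (hf : PCS f α) (hg : PCS g β)
    (hφm : StrictMonoOn φ (Icc 0 1)) (hφbij : BijOn φ (Icc 0 1) (Icc 0 1))
    (hconj : ∀ x ∈ Icc (0 : ℝ) 1, φ (f x) = g (φ x)) :
    ∃ S : Set ℝ, S.Finite ∧ GoodMap f φ α β S := by
  obtain ⟨S, hS, h1⟩ := hf.finset
  obtain ⟨T, hT, h2⟩ := hg.finset
  refine ⟨S ∪ (Icc 0 1 ∩ φ ⁻¹' T), hS.union ?_, ?_⟩
  · exact Set.Finite.of_injOn (f := φ) (t := T) (fun x hx => hx.2)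
      (hφm.injOn.mono inter_subset_left) hT
  · intro x hx y hy hxy hz
    refine ⟨h1 x hx y hy hxy fun z h => hz z (Or.inl h), ?_⟩
    rw [hconj x hx, hconj y hy]
    refine h2 _ (hφbij.mapsTo hx) _ (hφbij.mapsTo hy) (hφm.monotoneOn hx hy hxy) ?_
    rintro w hw ⟨ha, hb⟩
    obtain ⟨u, hu, rfl⟩ := hφbij.surjOn
      ⟨(hφbij.mapsTo hx).1.trans ha.le, hb.le.trans (hφbij.mapsTo hy).2⟩
    exact hz u (Or.inr ⟨hu, hw⟩) ⟨(hφm.lt_iff_lt hx hu).1 ha, (hφm.lt_iff_lt hu hy).1 hb⟩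

lemma core2 {f g φ : ℝ → ℝ} {α β : ℝ} (hf : MapsTo f (Icc 0 1) (Icc 0 1))
    (hfc : ContinuousOn f (Icc 0 1)) (hpf : PCS f α) (hpg : PCS g β)
    (hφc : ContinuousOn φ (Icc 0 1))
    (hφm : StrictMonoOn φ (Icc 0 1)) (hφbij : BijOn φ (Icc 0 1) (Icc 0 1))
    (hconj : ∀ x ∈ Icc (0 : ℝ) 1, φ (f x) = g (φ x)) (hα : 1 < α) (hle : α ≤ β) :
    α = β ∧ ∃ L a b, 0 ≤ a ∧ a < b ∧ b ≤ 1 ∧ φ b - φ a = L * (b - a) ∧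
      ∀ x ∈ Icc (0:ℝ) 1, ∀ y ∈ Icc (0:ℝ) 1, x ≤ y → φ y - φ x ≤ L * (y - x) := by
  obtain ⟨S, hS, hG⟩ := goodMap_of hpf hpg hφm hφbij hconj
  have hα0 : 0 < α := by linarith
  obtain ⟨n, hn⟩ := pow_unbounded_of_one_lt 2 (show 1 < β by linarith)
  obtain ⟨T, hT, hGT⟩ := iterate_good hS hf hfc hα0 hG n
  obtain ⟨h1, h2⟩ := core hT (hf.iterate n) hφbij.mapsTo hφc hφm
    (pow_le_pow_left₀ hα0.le hle n) hn hGT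
  refine ⟨?_, h2⟩
  have hn0 : n ≠ 0 := by
    rintro rfl
    norm_num at hn
  exact (pow_left_inj₀ hα0.le (by linarith) hn0).1 h1

/-- if `f, g : [0,1] → [0,1]` are continuous, transitive, piecewise
monotone maps of constant slopes `α` and `β` respectively, and `φ : [0,1] → [0,1]` is an
increasing homeomorphism with `φ ∘ f = g ∘ φ`, then `φ` is the identity; in particular
`f = g` and `α = β`. -/
theorem stmt_11 (f g φ : ℝ → ℝ) {α β : ℝ}
    (hf : MapsTo f (Icc 0 1) (Icc 0 1))
    (hfc : ContinuousOn f (Icc 0 1))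
    (hfslope : ∃ (m : ℕ) (s : ℕ → ℝ), 0 < m ∧ s 0 = 0 ∧ s m = 1 ∧
      (∀ j < m, s j < s (j + 1)) ∧
      ∀ j < m, ∀ u ∈ Icc (s j) (s (j + 1)), ∀ v ∈ Icc (s j) (s (j + 1)),
        |f u - f v| = α * |u - v|)
    (hftrans : ∃ x₀ ∈ Icc (0 : ℝ) 1,
      Icc (0 : ℝ) 1 ⊆ closure (Set.range fun n : ℕ => f^[n] x₀))
    (hg : MapsTo g (Icc 0 1) (Icc 0 1))
    (hgc : ContinuousOn g (Icc 0 1))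
    (hgslope : ∃ (m : ℕ) (s : ℕ → ℝ), 0 < m ∧ s 0 = 0 ∧ s m = 1 ∧
      (∀ j < m, s j < s (j + 1)) ∧
      ∀ j < m, ∀ u ∈ Icc (s j) (s (j + 1)), ∀ v ∈ Icc (s j) (s (j + 1)),
        |g u - g v| = β * |u - v|)
    (hgtrans : ∃ x₀ ∈ Icc (0 : ℝ) 1,
      Icc (0 : ℝ) 1 ⊆ closure (Set.range fun n : ℕ => g^[n] x₀))
    -- `φ` is an increasing homeomorphism of `[0,1]` onto itself
    (hφc : ContinuousOn φ (Icc 0 1))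
    (hφm : StrictMonoOn φ (Icc 0 1))
    (hφbij : BijOn φ (Icc 0 1) (Icc 0 1))
    -- `φ ∘ f = g ∘ φ`
    (hconj : ∀ x ∈ Icc (0 : ℝ) 1, φ (f x) = g (φ x)) :
    (∀ x ∈ Icc (0 : ℝ) 1, φ x = x) ∧ (∀ x ∈ Icc (0 : ℝ) 1, f x = g x) ∧ α = β := by
  have hpf : PCS f α := hfslope
  have hpg : PCS g β := hgslope
  have hα : 1 < α := slope_gt_one hf hfc hpf hftrans
  have hβ : 1 < β := slope_gt_one hg hgc hpg hgtrans
  let ψ := Function.invFunOn φ (Icc 0 1)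
  have hinv : InvOn ψ φ (Icc 0 1) (Icc 0 1) := hφbij.invOn_invFunOn
  have hψmaps : MapsTo ψ (Icc 0 1) (Icc 0 1) := hφbij.surjOn.mapsTo_invFunOn
  have hψbij : BijOn ψ (Icc 0 1) (Icc 0 1) := hinv.symm.bijOn hψmaps hφbij.mapsTo
  have hφψ : ∀ x ∈ Icc (0:ℝ) 1, φ (ψ x) = x := fun x hx => hinv.2 hx
  have hψφ : ∀ x ∈ Icc (0:ℝ) 1, ψ (φ x) = x := fun x hx => hinv.1 hx
  have hψm : StrictMonoOn ψ (Icc 0 1) := by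
    intro x hx y hy hxy
    rw [← hφm.lt_iff_lt (hψmaps hx) (hψmaps hy), hφψ x hx, hφψ y hy]
    exact hxy
  have hψc : ContinuousOn ψ (Icc 0 1) := by
    have h2 : Continuous (fun x : Icc (0:ℝ) 1 => (⟨ψ x, hψmaps x.2⟩ : Icc (0:ℝ) 1)) := by
      apply Monotone.continuous_of_surjective
      · intro x y hxy
        exact hψm.monotoneOn x.2 y.2 hxy
      · rintro ⟨y, hy⟩
        exact ⟨⟨φ y, hφbij.mapsTo hy⟩, Subtype.ext (hψφ y hy)⟩
    rw [continuousOn_iff_continuous_domRestrict]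
    exact continuous_subtype_val.comp h2
  have hconj' : ∀ x ∈ Icc (0:ℝ) 1, ψ (g x) = f (ψ x) := by
    intro x hx
    have h1 := hconj (ψ x) (hψmaps hx)
    rw [hφψ x hx] at h1
    rw [← h1, hψφ _ (hf (hψmaps hx))]
  have hab : α = β := by
    rcases le_total α β with h | h
    · exact (core2 hf hfc hpf hpg hφc hφm hφbij hconj hα h).1
    · exact (core2 hg hgc hpg hpf hψc hψm hψbij hconj' hβ h).1.symm
  obtain ⟨-, L, a, b, ha, hlt, hb, he, hL⟩ :=
    core2 hf hfc hpf hpg hφc hφm hφbij hconj hα hab.le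
  obtain ⟨-, M, c, d, hc, hcd, hd, he', hM⟩ :=
    core2 hg hgc hpg hpf hψc hψm hψbij hconj' hβ hab.ge
  have hcI : c ∈ Icc (0:ℝ) 1 := ⟨hc, by linarith⟩
  have hdI : d ∈ Icc (0:ℝ) 1 := ⟨by linarith, hd⟩
  have haI : a ∈ Icc (0:ℝ) 1 := ⟨ha, by linarith⟩
  have hbI : b ∈ Icc (0:ℝ) 1 := ⟨by linarith, hb⟩
  have hM' : ∀ x ∈ Icc (0:ℝ) 1, ∀ y ∈ Icc (0:ℝ) 1, x ≤ y → y - x ≤ M * (φ y - φ x) := by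
    intro x hx y hy hxy
    have := hM _ (hφbij.mapsTo hx) _ (hφbij.mapsTo hy) (hφm.monotoneOn hx hy hxy)
    rwa [hψφ x hx, hψφ y hy] at this
  have hLsub : ∀ x y, a ≤ x → x ≤ y → y ≤ b → φ y - φ x = L * (y - x) := by
    intro x y h1 h2 h3
    have hx : x ∈ Icc (0:ℝ) 1 := ⟨by linarith, by linarith⟩
    have hy : y ∈ Icc (0:ℝ) 1 := ⟨by linarith, by linarith⟩
    have e1 := hL a haI x hx h1
    have e2 := hL y hy b hbI h3
    have e3 := hL x hx y hy h2
    nlinarith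
  have hMsub : ∀ x y, ψ c ≤ x → x ≤ y → y ≤ ψ d → y - x = M * (φ y - φ x) := by
    intro x y h1 h2 h3
    have hc' := hψmaps hcI
    have hd' := hψmaps hdI
    have hx : x ∈ Icc (0:ℝ) 1 := ⟨hc'.1.trans h1, by linarith [hd'.2]⟩
    have hy : y ∈ Icc (0:ℝ) 1 := ⟨by linarith [hc'.1], h3.trans hd'.2⟩
    have e1 := hM' _ hc' x hx h1
    have e2 := hM' y hy _ hd' h3
    have e3 := hM' x hx y hy h2
    rw [hφψ c hcI] at e1
    rw [hφψ d hdI] at e2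
    nlinarith
  have hML : M * L = 1 := by
    obtain ⟨x₀, hx₀, hdense⟩ := hftrans
    obtain ⟨p, -, hp⟩ := orbit_hits hdense ha hlt hb 0
    obtain ⟨q, hpq, hq⟩ := orbit_hits hdense (hψmaps hcI).1 (hψm hcI hdI hcd) (hψmaps hdI).2 p
    obtain ⟨n, rfl⟩ := Nat.exists_eq_add_of_le hpq
    rw [add_comm, Function.iterate_add_apply] at hq
    set y₀ := f^[p] x₀ with hy₀
    have hit : ContinuousOn f^[n] (Icc 0 1) := hfc.iterate hf n
    have hnh : Icc (0:ℝ) 1 ∈ nhds y₀ :=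
      Icc_mem_nhds (by linarith [hp.1]) (by linarith [hp.2])
    have hev : ∀ᶠ y in nhds y₀, y ∈ Ioo a b ∧ f^[n] y ∈ Ioo (ψ c) (ψ d) :=
      (show ∀ᶠ y in nhds y₀, y ∈ Ioo a b from Ioo_mem_nhds hp.1 hp.2).and
        ((hit.continuousAt hnh).eventually (Ioo_mem_nhds hq.1 hq.2))
    obtain ⟨e, he0, hball⟩ := Metric.eventually_nhds_iff.1 hev
    obtain ⟨S, hS, hG⟩ := goodMap_of hpf hpg hφm hφbij hconj
    obtain ⟨T, hT, hGT⟩ := iterate_good hS hf hfc (by linarith) hG n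
    obtain ⟨x, y, h1, h2, h3, h4⟩ := exists_gap hT (show y₀ < y₀ + e by linarith)
    have hxx := @hball x (by rw [Real.dist_eq, abs_of_pos (by linarith)]; linarith)
    have hyy := @hball y (by rw [Real.dist_eq, abs_of_pos (by linarith)]; linarith)
    have hxI : x ∈ Icc (0:ℝ) 1 := ⟨by linarith [hxx.1.1], by linarith [hxx.1.2]⟩
    have hyI : y ∈ Icc (0:ℝ) 1 := ⟨by linarith [hyy.1.1], by linarith [hyy.1.2]⟩
    obtain ⟨g1, g2⟩ := hGT x hxI y hyI h2.le h4
    have k1 := hLsub x y hxx.1.1.le h2.le hyy.1.2.le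
    rw [abs_sub_comm x, abs_of_pos (sub_pos.2 h2)] at g1
    rw [abs_sub_comm (φ x), abs_of_pos (sub_pos.2 (hφm hxI hyI h2)), k1, ← hab] at g2
    have k2 : |f^[n] x - f^[n] y| = M * |φ (f^[n] x) - φ (f^[n] y)| := by
      have m1 := hf.iterate n hxI
      have m2 := hf.iterate n hyI
      rcases le_total (f^[n] x) (f^[n] y) with hle | hle
      · rw [abs_sub_comm, abs_sub_comm (φ _), abs_of_nonneg (sub_nonneg.2 hle),
          abs_of_nonneg (sub_nonneg.2 (hφm.monotoneOn m1 m2 hle))]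
        exact hMsub _ _ hxx.2.1.le hle hyy.2.2.le
      · rw [abs_of_nonneg (sub_nonneg.2 hle),
          abs_of_nonneg (sub_nonneg.2 (hφm.monotoneOn m2 m1 hle))]
        exact hMsub _ _ hyy.2.1.le hle hxx.2.2.le
    rw [g1, g2] at k2
    have hpos : 0 < α ^ n * (y - x) := mul_pos (by positivity) (sub_pos.2 h2)
    have : (M * L) * (α ^ n * (y - x)) = 1 * (α ^ n * (y - x)) := by linarith
    exact mul_right_cancel₀ hpos.ne' this
  have h0m : (0:ℝ) ∈ Icc (0:ℝ) 1 := by simp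
  have h1m : (1:ℝ) ∈ Icc (0:ℝ) 1 := by simp
  have hφ0 : φ 0 = 0 := by
    have := hφm.monotoneOn h0m (hψmaps h0m) (hψmaps h0m).1
    rw [hφψ 0 h0m] at this
    exact le_antisymm this (hφbij.mapsTo h0m).1
  have hφ1 : φ 1 = 1 := by
    have := hφm.monotoneOn (hψmaps h1m) h1m (hψmaps h1m).2
    rw [hφψ 1 h1m] at this
    exact le_antisymm (hφbij.mapsTo h1m).2 this
  have hL1 : 1 ≤ L := by
    have := hL 0 h0m 1 h1m zero_le_one
    rw [hφ0, hφ1] at this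
    linarith
  have hM1 : 1 ≤ M := by
    have := hM' 0 h0m 1 h1m zero_le_one
    rw [hφ0, hφ1] at this
    linarith
  have hLe : L = 1 := by nlinarith
  have hid : ∀ x ∈ Icc (0 : ℝ) 1, φ x = x := by
    intro x hx
    have e1 := hL 0 h0m x hx hx.1
    have e2 := hL x hx 1 h1m hx.2
    rw [hφ0, hLe] at e1
    rw [hφ1, hLe] at e2
    linarith
  refine ⟨hid, ?_, hab⟩
  intro x hx
  have := hconj x hx
  rwa [hid _ (hf hx), hid x hx] at this
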